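/- arXiv:1302.1145 — 2 statements merged into one kernel-verified Lean document; each statement's English description precedes it below -/
import Mathlib

section
/- Let m and k be positive integers. Then every graph whose chromatic number is greater than max{2k² + k, m + 2k² − 1} contains a (k+1)-connected induced subgraph of chromatic number at least m. -/
/-- A graph is `n`-connected if it has more than `n` vertices and remains
connected after the deletion of any set of fewer than `n` vertices.
(So for `n = k + 1`: more than `k + 1` vertices and connected after deleting
any set of at most `k` vertices.) -/
def IsNConnected {W : Type*} (n : ℕ) (G : SimpleGraph W) : Prop :=
  n < Nat.card W ∧ ∀ S : Set W, S.ncard + 1 ≤ n → (G.induce Sᶜ).Connected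

namespace SimpleGraph

open Finset

variable {V : Type*}

/-- Colorability of an induced subgraph, expressed by a function on the ambient vertex type. -/
lemma induce_colorable_iff (G : SimpleGraph V) (s : Set V) (n : ℕ) :
    (G.induce s).Colorable n ↔
      ∃ f : V → ℕ, (∀ v ∈ s, f v < n) ∧ ∀ u ∈ s, ∀ v ∈ s, G.Adj u v → f u ≠ f v := by
  classical
  constructor
  · rintro ⟨f⟩
    refine ⟨fun v => if h : v ∈ s then (f ⟨v, h⟩ : ℕ) else 0, fun v hv => ?_, ?_⟩
    · simp [hv]
    · intro u hu v hv huv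
      have : f ⟨u, hu⟩ ≠ f ⟨v, hv⟩ := f.valid (by simpa using huv)
      simpa [hu, hv, Fin.ext_iff] using this
  · rintro ⟨f, hf, hfG⟩
    refine ⟨Coloring.mk (fun v => ⟨f v, hf v v.2⟩) ?_⟩
    intro u v huv
    simpa [Fin.ext_iff] using hfG u u.2 v v.2 (by simpa using huv)

/-- A set of vertices without small separations induces a highly connected subgraph. -/
lemma isNConnected_induce_of_separation [DecidableEq V] (G : SimpleGraph V) (X : Finset V) (n : ℕ)
    (hX : n < #X)
    (h : ∀ C D S : Finset V, Disjoint C D → Disjoint C S → Disjoint D S → C ∪ D ∪ S = X →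
      C.Nonempty → D.Nonempty → (∀ u ∈ C, ∀ v ∈ D, ¬ G.Adj u v) → n ≤ #S) :
    IsNConnected n (G.induce (X : Set V)) := by
  classical
  refine ⟨by simpa using hX, fun S hS => ?_⟩
  by_contra hconn
  have hne : Nonempty (Sᶜ : Set (X : Set V)) := by
    by_contra hempty
    have hS' : S = Set.univ := by
      rw [← Set.compl_empty_iff]
      exact Set.not_nonempty_iff_eq_empty.mp fun ⟨x, hx⟩ => hempty ⟨x, hx⟩
    have : S.ncard = #X := by simp [hS', Set.ncard_univ]
    omega
  set H := (G.induce (X : Set V)).induce Sᶜ with hH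
  have hpre : ¬ H.Preconnected := fun hp => hconn ⟨hp⟩
  simp only [Preconnected, not_forall] at hpre
  obtain ⟨a, b, hab⟩ := hpre
  let S' := X.filter fun v => ∃ hv : v ∈ (X : Set V), (⟨v, hv⟩ : (X : Set V)) ∈ S
  let C := X.filter fun v => ∃ (hv : v ∈ (X : Set V)) (hvS : (⟨v, hv⟩ : (X : Set V)) ∈ Sᶜ),
    H.Reachable a ⟨⟨v, hv⟩, hvS⟩
  let D := X.filter fun v => ∃ (hv : v ∈ (X : Set V)) (hvS : (⟨v, hv⟩ : (X : Set V)) ∈ Sᶜ),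
    ¬ H.Reachable a ⟨⟨v, hv⟩, hvS⟩
  have hcard : #S' = S.ncard := by
    have : (S' : Set V) = Subtype.val '' S := by
      ext v
      simp [S']
    rw [← Set.ncard_coe_finset, this, Set.ncard_image_of_injective _ Subtype.val_injective]
  have := h C D S' ?_ ?_ ?_ ?_ ?_ ?_ ?_
  · omega
  · refine Finset.disjoint_left.mpr fun v hv hv' => ?_
    obtain ⟨-, h1, h2, h3⟩ := Finset.mem_filter.mp hv
    obtain ⟨-, h1', h2', h3'⟩ := Finset.mem_filter.mp hv'
    exact h3' h3
  · refine Finset.disjoint_left.mpr fun v hv hv' => ?_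
    obtain ⟨-, h1, h2, h3⟩ := Finset.mem_filter.mp hv
    obtain ⟨-, h1', h2'⟩ := Finset.mem_filter.mp hv'
    exact h2 h2'
  · refine Finset.disjoint_left.mpr fun v hv hv' => ?_
    obtain ⟨-, h1, h2, h3⟩ := Finset.mem_filter.mp hv
    obtain ⟨-, h1', h2'⟩ := Finset.mem_filter.mp hv'
    exact h2 h2'
  · ext v
    simp only [Finset.mem_union]
    constructor
    · rintro ((hv | hv) | hv) <;> exact (Finset.mem_filter.mp hv).1
    · intro hv
      by_cases hvS : (⟨v, hv⟩ : (X : Set V)) ∈ S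
      · exact Or.inr (Finset.mem_filter.mpr ⟨hv, hv, hvS⟩)
      · by_cases hr : H.Reachable a ⟨⟨v, hv⟩, hvS⟩
        · exact Or.inl (Or.inl (Finset.mem_filter.mpr ⟨hv, hv, hvS, hr⟩))
        · exact Or.inl (Or.inr (Finset.mem_filter.mpr ⟨hv, hv, hvS, hr⟩))
  · exact ⟨a.1.1, Finset.mem_filter.mpr ⟨a.1.2, a.1.2, a.2, Reachable.refl _⟩⟩
  · exact ⟨b.1.1, Finset.mem_filter.mpr ⟨b.1.2, b.1.2, b.2, hab⟩⟩
  · intro u hu v hv huv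
    obtain ⟨-, h1, h2, h3⟩ := Finset.mem_filter.mp hu
    obtain ⟨-, h1', h2', h3'⟩ := Finset.mem_filter.mp hv
    refine h3' (h3.trans (Adj.reachable ?_))
    simpa [hH] using huv

section Boundary

variable [DecidableEq V] (G : SimpleGraph V) [DecidableRel G.Adj]

/-- The number of neighbors of `v` in `T` outside of `X`, truncated at `k`. -/
def truncExtDegree (T : Finset V) (k : ℕ) (X : Finset V) (v : V) : ℕ :=
  min k #{u ∈ T \ X | G.Adj v u}

variable {G}

/-- One side of a separation of small order either inherits the boundary bound, or it is so small
that it can be removed without raising the weight of the boundary. -/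
lemma exists_ssubset_of_separation {T X C D S : Finset V} {k : ℕ}
    (hdeg : ∀ v ∈ T, 2 * k ^ 2 + k ≤ #{u ∈ T | G.Adj v u}) (hk : 0 < k) (hXT : X ⊆ T)
    (hCD : Disjoint C D) (hCS : Disjoint C S) (hDS : Disjoint D S) (hX : C ∪ D ∪ S = X)
    (hC : C.Nonempty) (hD : D.Nonempty) (hadj : ∀ u ∈ C, ∀ v ∈ D, ¬ G.Adj u v) (hS : #S ≤ k)
    (hcard : 2 * k ^ 2 + k < #X) (hw : ∑ v ∈ X, G.truncExtDegree T k X v ≤ 2 * k ^ 2)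
    (hwC : ∑ v ∈ C, G.truncExtDegree T k X v ≤ k ^ 2) :
    ∃ Y ⊂ X, 2 * k ^ 2 < #Y ∧ ∑ v ∈ Y, G.truncExtDegree T k Y v ≤ 2 * k ^ 2 := by
  have hCDS : Disjoint (C ∪ D) S := Finset.disjoint_union_left.mpr ⟨hCS, hDS⟩
  have hXcard : #C + #D + #S = #X := by
    rw [← hX, Finset.card_union_of_disjoint hCDS, Finset.card_union_of_disjoint hCD]
  have hCcard := hC.card_pos
  have hDcard := hD.card_pos
  by_cases hbig : 2 * k ^ 2 < #(C ∪ S)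
  · refine ⟨C ∪ S, ?_, hbig, ?_⟩
    · refine (Finset.ssubset_iff_subset_ne).mpr ⟨by grind, fun h => ?_⟩
      have := congrArg Finset.card h
      rw [Finset.card_union_of_disjoint hCS] at this
      omega
    · rw [Finset.sum_union hCS]
      have h1 : ∑ v ∈ C, G.truncExtDegree T k (C ∪ S) v ≤ ∑ v ∈ C, G.truncExtDegree T k X v := by
        refine Finset.sum_le_sum fun v hv => min_le_min_left _ (Finset.card_le_card ?_)
        intro u hu
        simp only [Finset.mem_filter, Finset.mem_sdiff] at hu ⊢
        refine ⟨⟨hu.1.1, fun hux => ?_⟩, hu.2⟩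
        have : u ∈ D := by grind
        exact hadj v hv u this hu.2
      have h2 : ∑ v ∈ S, G.truncExtDegree T k (C ∪ S) v ≤ #S * k :=
        Finset.sum_le_card_nsmul _ _ _ fun v _ => min_le_left _ _
      nlinarith
  · have hCdeg : ∀ v ∈ C, G.truncExtDegree T k X v = k := by
      intro v hv
      refine min_eq_left ?_
      have hvT : v ∈ T := hXT (by grind)
      have hsub : {u ∈ T | G.Adj v u} ⊆ (C ∪ S) ∪ {u ∈ T \ X | G.Adj v u} := by
        intro u hu
        have := hadj v hv u
        grind
      have := (Finset.card_le_card hsub).trans (Finset.card_union_le _ _)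
      have := hdeg v hvT
      omega
    have hsumC : ∑ v ∈ C, G.truncExtDegree T k X v = #C * k := by
      rw [Finset.sum_congr rfl hCdeg, Finset.sum_const, smul_eq_mul]
    have hCk : #C ≤ k := by
      rw [hsumC] at hwC
      nlinarith
    have hcardDS : #(D ∪ S) = #D + #S := Finset.card_union_of_disjoint hDS
    refine ⟨D ∪ S, ?_, by omega, ?_⟩
    · refine (Finset.ssubset_iff_subset_ne).mpr ⟨by grind, fun h => ?_⟩
      have := congrArg Finset.card h
      omega
    · rw [Finset.sum_union hDS]
      rw [← hX, Finset.sum_union hCDS, Finset.sum_union hCD, hX, hsumC] at hw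
      have h1 : ∑ v ∈ D, G.truncExtDegree T k (D ∪ S) v ≤ ∑ v ∈ D, G.truncExtDegree T k X v := by
        refine Finset.sum_le_sum fun v hv => min_le_min_left _ (Finset.card_le_card ?_)
        intro u hu
        simp only [Finset.mem_filter, Finset.mem_sdiff] at hu ⊢
        refine ⟨⟨hu.1.1, fun hux => ?_⟩, hu.2⟩
        have : u ∈ C := by grind
        exact hadj u this v hv hu.2.symm
      have h2 : ∑ v ∈ S, G.truncExtDegree T k (D ∪ S) v ≤
          ∑ v ∈ S, (G.truncExtDegree T k X v + #C) := by
        refine Finset.sum_le_sum fun v _ => ?_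
        have hsub : {u ∈ T \ (D ∪ S) | G.Adj v u} ⊆ {u ∈ T \ X | G.Adj v u} ∪ C := by grind
        have := (Finset.card_le_card hsub).trans (Finset.card_union_le _ _)
        unfold truncExtDegree
        omega
      rw [Finset.sum_add_distrib, Finset.sum_const, smul_eq_mul] at h2
      nlinarith

/-- A graph of large minimum degree has a highly connected induced subgraph with few vertices that
have neighbors outside of it. -/
lemma exists_isNConnected_induce_card_boundary_le {T : Finset V} {k : ℕ}
    (hdeg : ∀ v ∈ T, 2 * k ^ 2 + k ≤ #{u ∈ T | G.Adj v u}) (hk : 0 < k) (hT : T.Nonempty) :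
    ∃ X ⊆ T, IsNConnected (k + 1) (G.induce (X : Set V)) ∧
      #{v ∈ X | ∃ u ∈ T \ X, G.Adj v u} ≤ 2 * k ^ 2 ∧ 2 * k ^ 2 < #X := by
  have hcard_lt : ∀ X ⊆ T, ∀ v ∈ X, (∀ u ∈ T \ X, ¬ G.Adj v u) → 2 * k ^ 2 + k < #X := by
    intro X hXT v hv hint
    have hsub : {u ∈ T | G.Adj v u} ⊆ X.erase v := by
      intro u hu
      have := hint u
      have := G.loopless.irrefl v
      grind
    have := Finset.card_le_card hsub
    rw [Finset.card_erase_of_mem hv] at this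
    have := Finset.card_pos.mpr ⟨v, hv⟩
    have := hdeg v (hXT hv)
    omega
  let P : Finset V → Prop := fun X =>
    X ⊆ T ∧ 2 * k ^ 2 < #X ∧ ∑ v ∈ X, G.truncExtDegree T k X v ≤ 2 * k ^ 2
  have hP : ∃ X, P X := by
    obtain ⟨v, hv⟩ := hT
    have := hcard_lt T subset_rfl v hv (by simp)
    exact ⟨T, subset_rfl, by omega, by simp [truncExtDegree]⟩
  obtain ⟨X, ⟨hXT, hXcard, hXw⟩, hmin⟩ := WellFounded.has_min
    (wellFounded_lt : WellFounded ((· < ·) : Finset V → Finset V → Prop)) {X | P X} hP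
  have hbdry : #{v ∈ X | ∃ u ∈ T \ X, G.Adj v u} ≤ 2 * k ^ 2 := by
    refine le_trans ?_ hXw
    rw [Finset.card_filter]
    refine Finset.sum_le_sum fun v _ => ?_
    split_ifs with h
    · obtain ⟨u, hu, huv⟩ := h
      exact le_min hk (Finset.card_pos.mpr ⟨u, Finset.mem_filter.mpr ⟨hu, huv⟩⟩)
    · exact Nat.zero_le _
  obtain ⟨v, hv, hvint⟩ : ∃ v ∈ X, ∀ u ∈ T \ X, ¬ G.Adj v u := by
    by_contra! hcon
    rw [Finset.filter_true_of_mem hcon] at hbdry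
    omega
  have hX' := hcard_lt X hXT v hv hvint
  have hno : ¬ ∃ Y ⊂ X, 2 * k ^ 2 < #Y ∧ ∑ v ∈ Y, G.truncExtDegree T k Y v ≤ 2 * k ^ 2 :=
    fun ⟨Y, hYX, h1, h2⟩ => hmin Y ⟨hYX.subset.trans hXT, h1, h2⟩ hYX
  refine ⟨X, hXT, isNConnected_induce_of_separation G X (k + 1) (by nlinarith) ?_, hbdry, hXcard⟩
  intro C D S hCD hCS hDS hX hC hD hadj
  by_contra! hS
  have hsum : ∑ v ∈ C, G.truncExtDegree T k X v + ∑ v ∈ D, G.truncExtDegree T k X v ≤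
      2 * k ^ 2 := by
    rw [← Finset.sum_union hCD]
    exact (Finset.sum_le_sum_of_subset (hX ▸ Finset.subset_union_left)).trans hXw
  rcases le_total (∑ v ∈ C, G.truncExtDegree T k X v) (k ^ 2) with h | h
  · exact hno (exists_ssubset_of_separation hdeg hk hXT hCD hCS hDS hX hC hD hadj (by omega) hX'
      hXw h)
  · exact hno (exists_ssubset_of_separation hdeg hk hXT hCD.symm hDS hCS
      (by rw [Finset.union_comm D C, hX]) hD hC
      (fun u hu v hv huv => hadj v hv u hu huv.symm) (by omega) hX' hXw (by omega))

/-- A coloring of all but one vertex extends if that vertex has few neighbors. -/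
lemma induce_colorable_of_erase {T : Finset V} {c : ℕ} {v : V}
    (hcol : (G.induce (T.erase v : Set V)).Colorable c) (hdeg : #{u ∈ T | G.Adj v u} < c) :
    (G.induce (T : Set V)).Colorable c := by
  rw [induce_colorable_iff] at hcol ⊢
  obtain ⟨f, hf, hfG⟩ := hcol
  obtain ⟨x, hx, hxf⟩ : ∃ x ∈ Finset.range c, x ∉ ({u ∈ T | G.Adj v u}).image f := by
    refine Finset.exists_mem_notMem_of_card_lt_card ?_
    rw [Finset.card_range]
    exact Finset.card_image_le.trans_lt hdeg
  simp only [Finset.mem_image, Finset.mem_filter, not_exists, not_and] at hxf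
  simp only [Finset.mem_coe, Finset.mem_erase] at hf hfG ⊢
  have hirr := G.loopless.irrefl v
  refine ⟨Function.update f v x, fun u hu => ?_, fun u hu w hw huw => ?_⟩
  · by_cases huv : u = v
    · subst huv; simpa using hx
    · simpa [huv] using hf u ⟨huv, hu⟩
  · by_cases huv : u = v
    · subst huv
      have hwu : w ≠ u := fun h => hirr (h ▸ huw)
      simpa [hwu] using fun h => hxf w ⟨hw, huw⟩ h.symm
    · by_cases hwv : w = v
      · subst hwv
        simpa [huv] using fun h => hxf u ⟨hu, huw.symm⟩ h
      · simpa [huv, hwv] using hfG u ⟨huv, hu⟩ w ⟨hwv, hw⟩ huw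

/-- A coloring outside of the interior of `X` extends to the interior if sufficiently many colors
do not appear on the boundary of `X`. -/
lemma induce_colorable_of_boundary {T X : Finset V} {c b n : ℕ}
    (hbdry : #{v ∈ X | ∃ u ∈ T \ X, G.Adj v u} ≤ b) (hc : n + b ≤ c)
    (hX : (G.induce (X : Set V)).Colorable n)
    (hT : (G.induce ((T \ {v ∈ X | ∀ u ∈ T \ X, ¬ G.Adj v u} : Finset V) : Set V)).Colorable c) :
    (G.induce (T : Set V)).Colorable c := by
  rw [induce_colorable_iff] at hX hT ⊢
  obtain ⟨g, hg, hgG⟩ := hX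
  obtain ⟨f, hf, hfG⟩ := hT
  set I : Finset V := {v ∈ X | ∀ u ∈ T \ X, ¬ G.Adj v u} with hI
  set F : Finset ℕ := ({v ∈ X | ∃ u ∈ T \ X, G.Adj v u}).image f with hF
  have hpal : n ≤ #(Finset.range c \ F) := by
    have h1 : #F ≤ b := Finset.card_image_le.trans hbdry
    have h2 := Finset.le_card_sdiff F (Finset.range c)
    rw [Finset.card_range] at h2
    omega
  let e : ℕ → ℕ := fun i => if h : i < n then
    (Finset.range c \ F).orderEmbOfCardLe hpal ⟨i, h⟩ else 0
  have he : ∀ i < n, e i ∈ Finset.range c \ F := fun i hi => by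
    simpa only [e, hi, dif_pos] using Finset.orderEmbOfCardLe_mem _ hpal _
  have heinj : ∀ i < n, ∀ j < n, e i = e j → i = j := fun i hi j hj hij => by
    simpa [e, hi, hj] using hij
  have hIX : ∀ v ∈ I, v ∈ X := fun v hv => (Finset.mem_filter.mp hv).1
  have hcross : ∀ u ∈ I, ∀ v ∈ T, v ∉ I → G.Adj u v → e (g u) ≠ f v := by
    intro u hu v hv hvI huv heq
    have hvX : v ∈ X := by
      by_contra hvX
      exact (Finset.mem_filter.mp hu).2 v (Finset.mem_sdiff.mpr ⟨hv, hvX⟩) huv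
    have hvF : f v ∈ F := by
      refine Finset.mem_image_of_mem f (Finset.mem_filter.mpr ⟨hvX, ?_⟩)
      by_contra! hcon
      exact hvI (Finset.mem_filter.mpr ⟨hvX, hcon⟩)
    exact (Finset.mem_sdiff.mp (he _ (hg u (hIX u hu)))).2 (heq ▸ hvF)
  refine ⟨fun v => if v ∈ I then e (g v) else f v, fun v hv => ?_, fun u hu v hv huv => ?_⟩
  · by_cases hvI : v ∈ I
    · simpa [hvI] using (Finset.mem_sdiff.mp (he _ (hg v (hIX v hvI)))).1
    · simpa [hvI] using hf v (Finset.mem_coe.mpr (Finset.mem_sdiff.mpr ⟨hv, hvI⟩))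
  · by_cases huI : u ∈ I <;> by_cases hvI : v ∈ I
    · simp only [huI, hvI, if_true]
      exact fun h => hgG u (hIX u huI) v (hIX v hvI) huv
        (heinj _ (hg u (hIX u huI)) _ (hg v (hIX v hvI)) h)
    · simpa only [huI, hvI, if_true, if_false] using hcross u huI v hv hvI huv
    · simpa only [huI, hvI, if_true, if_false] using (hcross v hvI u hu huI huv.symm).symm
    · simpa only [huI, hvI, if_false] using
        hfG u (Finset.mem_coe.mpr (Finset.mem_sdiff.mpr ⟨hu, huI⟩)) v
          (Finset.mem_coe.mpr (Finset.mem_sdiff.mpr ⟨hv, hvI⟩)) huv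

/-- If all highly connected induced subgraphs have small chromatic number, then so do all finite
induced subgraphs. -/
lemma induce_colorable_of_forall_isNConnected {k n c : ℕ} (hk : 0 < k)
    (hc : 2 * k ^ 2 + k ≤ c) (hc' : n + 2 * k ^ 2 ≤ c)
    (h : ∀ s : Set V, IsNConnected (k + 1) (G.induce s) → (G.induce s).Colorable n)
    (T : Finset V) : (G.induce (T : Set V)).Colorable c := by
  induction T using Finset.strongInduction with
  | H T ih =>
  rcases T.eq_empty_or_nonempty with rfl | hT
  · exact (induce_colorable_iff _ _ _).mpr ⟨fun _ => 0, by simp, by simp⟩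
  by_cases hdeg : ∀ v ∈ T, c ≤ #{u ∈ T | G.Adj v u}
  · obtain ⟨X, hXT, hX, hbdry, hcard⟩ := exists_isNConnected_induce_card_boundary_le
      (fun v hv => hc.trans (hdeg v hv)) hk hT
    refine induce_colorable_of_boundary hbdry hc' (h _ hX) (ih _ ?_)
    obtain ⟨v, hv, hvint⟩ : ∃ v ∈ X, ∀ u ∈ T \ X, ¬ G.Adj v u := by
      by_contra! hcon
      rw [Finset.filter_true_of_mem hcon] at hbdry
      omega
    exact Finset.sdiff_ssubset ((Finset.filter_subset _ _).trans hXT)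
      ⟨v, Finset.mem_filter.mpr ⟨hv, hvint⟩⟩
  · push Not at hdeg
    obtain ⟨v, hv, hlt⟩ := hdeg
    exact induce_colorable_of_erase (ih _ (Finset.erase_ssubset hv)) hlt

end Boundary

end SimpleGraph

theorem highly_connected_subgraph_of_large_chromatic (m k : ℕ) (hm : 0 < m) (hk : 0 < k)
    (V : Type) [Fintype V] (G : SimpleGraph V)
    (h : ((max (2 * k ^ 2 + k) (m + 2 * k ^ 2 - 1) : ℕ) : ℕ∞) < G.chromaticNumber) :
    ∃ s : Set V, IsNConnected (k + 1) (G.induce s) ∧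
      (m : ℕ∞) ≤ (G.induce s).chromaticNumber := by
  classical
  by_contra! hcon
  refine absurd h (not_lt.mpr (SimpleGraph.Colorable.chromaticNumber_le ?_))
  have hcol := SimpleGraph.induce_colorable_of_forall_isNConnected (G := G) (n := m - 1) hk
    (le_max_left (2 * k ^ 2 + k) (m + 2 * k ^ 2 - 1)) (by omega) (fun s hs => ?_) Finset.univ
  · obtain ⟨f, hf, hfG⟩ := (SimpleGraph.induce_colorable_iff _ _ _).mp hcol
    exact ⟨SimpleGraph.Coloring.mk (fun v => ⟨f v, hf v (by simp)⟩) fun {u v} huv => by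
      simpa [Fin.ext_iff] using hfG u (by simp) v (by simp) huv⟩
  · have hlt := hcon s hs
    rw [← SimpleGraph.chromaticNumber_le_iff_colorable]
    refine Order.le_of_lt_add_one ?_
    have : ((m - 1 : ℕ) : ℕ∞) + 1 = m := by exact_mod_cast Nat.sub_add_cancel hm
    rwa [this]
end

section
/- Let k be a positive integer. Then the class of graphs of separability at most k is χ-bounded by the linear function f(x) = x + 2k² − 1; that is, every graph G of separability at most k satisfies χ(H) ≤ ω(H) + 2k² − 1 for every induced subgraph H of G. -/
/-- `G` has separability at most `k`: every two distinct non-adjacent vertices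
`u, v` are separated by a set `S` of at most `k` other vertices, i.e. `u` and
`v` lie in different components of `G ∖ S`. -/
def SeparabilityAtMost {V : Type*} (G : SimpleGraph V) (k : ℕ) : Prop :=
  ∀ u v : V, u ≠ v → ¬ G.Adj u v →
    ∃ S : Set V, S.ncard ≤ k ∧ ∃ (hu : u ∈ Sᶜ) (hv : v ∈ Sᶜ),
      ¬ (G.induce Sᶜ).Reachable ⟨u, hu⟩ ⟨v, hv⟩

/-- The clique number `ω(G)`. -/
noncomputable def cliqueNum {V : Type*} (G : SimpleGraph V) : ℕ :=
  sSup {n | ∃ s : Finset V, G.IsNClique n s}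

/-- Any two distinct non-adjacent vertices `u, v` admit a vertex set `X` containing `u` but not `v`
all of whose outer neighbours lie in a set `S` of at most `k` vertices avoiding `v`. -/
def HasSmallCuts {V : Type*} (G : SimpleGraph V) (k : ℕ) : Prop :=
  ∀ u v : V, u ≠ v → ¬ G.Adj u v →
    ∃ S X : Finset V, S.card ≤ k ∧ u ∈ X ∧ v ∉ X ∧ v ∉ S ∧
      ∀ x ∈ X, ∀ y, G.Adj x y → y ∈ X ∨ y ∈ S

theorem SeparabilityAtMost.hasSmallCuts {V : Type*} [Fintype V] {G : SimpleGraph V} {k : ℕ}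
    (h : SeparabilityAtMost G k) : HasSmallCuts G k := by
  classical
  intro u v huv hadj
  obtain ⟨S, hS, hu, hv, hr⟩ := h u v huv hadj
  refine ⟨S.toFinset,
    Finset.univ.filter fun x => ∃ hx : x ∈ Sᶜ, (G.induce Sᶜ).Reachable ⟨u, hu⟩ ⟨x, hx⟩,
    ?_, ?_, ?_, ?_, ?_⟩
  · rwa [← Set.ncard_eq_toFinset_card']
  · simpa using hu
  · simp only [Finset.mem_filter, Finset.mem_univ, true_and, not_exists]
    exact fun _ => hr
  · simpa using hv
  · simp only [Finset.mem_filter, Finset.mem_univ, true_and, Set.mem_toFinset]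
    rintro x ⟨hx, hxr⟩ y hxy
    by_cases hy : y ∈ S
    · exact Or.inr hy
    · have hadj' : (G.induce Sᶜ).Adj ⟨x, hx⟩ ⟨y, hy⟩ := hxy
      exact Or.inl ⟨hy, hxr.trans hadj'.reachable⟩

theorem HasSmallCuts.induce {V : Type*} {G : SimpleGraph V} {k : ℕ}
    (h : HasSmallCuts G k) (s : Set V) : HasSmallCuts (G.induce s) k := by
  classical
  intro u v huv hadj
  obtain ⟨S, X, hS, hu, hvX, hvS, hX⟩ := h u v (fun e => huv (Subtype.ext e)) hadj
  refine ⟨S.subtype (· ∈ s), X.subtype (· ∈ s), ?_, by simpa, by simpa, by simpa, ?_⟩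
  · rw [Finset.card_subtype]
    exact (Finset.card_filter_le _ _).trans hS
  · intro x hx y hxy
    simpa using hX x (by simpa using hx) y hxy

/-- A nonempty set `I` whose outer neighbours lie in a set of fewer than `2 * k` vertices contains
a vertex of small degree. -/
theorem HasSmallCuts.exists_degree_lt_of_boundary {V : Type*} [Fintype V] {G : SimpleGraph V}
    [DecidableRel G.Adj] {k m : ℕ} (h : HasSmallCuts G k) (hm : G.CliqueFree (m + 1))
    (I B : Finset V) (hI : I.Nonempty) (hB : B.card < 2 * k)
    (hIB : ∀ x ∈ I, ∀ y, G.Adj x y → y ∈ I ∨ y ∈ B) :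
    ∃ v, G.degree v < m + 2 * k - 1 := by
  classical
  induction I using Finset.strongInduction generalizing B with
  | H I ih =>
    by_cases hclique : G.IsClique (I : Set V)
    · obtain ⟨v, hv⟩ := hI
      have hIm : I.card ≤ m := by
        by_contra! hlt
        exact hm.mono hlt I ⟨hclique, rfl⟩
      have hsub : G.neighborFinset v ⊆ I.erase v ∪ B := by
        intro y hy
        rw [SimpleGraph.mem_neighborFinset] at hy
        have := hIB v hv y hy
        simp only [Finset.mem_union, Finset.mem_erase]
        exact this.imp_left fun hyI => ⟨hy.ne', hyI⟩
      have hcard := (Finset.card_le_card hsub).trans (Finset.card_union_le _ _)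
      rw [SimpleGraph.card_neighborFinset_eq_degree, Finset.card_erase_of_mem hv] at hcard
      have := Finset.card_pos.2 ⟨v, hv⟩
      exact ⟨v, by omega⟩
    · obtain ⟨u, hu, v, hv, huv, hadj⟩ : ∃ u ∈ I, ∃ v ∈ I, u ≠ v ∧ ¬ G.Adj u v := by
        simpa [SimpleGraph.isClique_iff, Set.Pairwise] using hclique
      obtain ⟨S, X, hS, huX, hvX, hvS, hX⟩ := h u v huv hadj
      have hsum := Finset.card_filter_add_card_filter_not (s := B) (· ∈ X)
      have h₁ := Finset.card_union_le (B.filter (· ∈ X)) S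
      have h₂ := Finset.card_union_le (B.filter (· ∉ X)) S
      by_cases hsmall : (B.filter (· ∈ X) ∪ S).card < 2 * k
      · refine ih (I.filter (· ∈ X)) (Finset.filter_ssubset.2 ⟨v, hv, hvX⟩)
          (B.filter (· ∈ X) ∪ S) ⟨u, by simp [hu, huX]⟩ hsmall ?_
        intro x hx y hxy
        simp only [Finset.mem_filter, Finset.mem_union] at hx ⊢
        have := hIB x hx.1 y hxy
        have := hX x hx.2 y hxy
        tauto
      · refine ih (I.filter fun x => x ∉ X ∧ x ∉ S)
          (Finset.filter_ssubset.2 ⟨u, hu, fun hn => hn.1 huX⟩)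
          (B.filter (· ∉ X) ∪ S) ⟨v, by simp [hv, hvX, hvS]⟩ (by omega) ?_
        intro x hx y hxy
        simp only [Finset.mem_filter, Finset.mem_union] at hx ⊢
        have := hIB x hx.1 y hxy
        have := fun hy => hX y hy x hxy.symm
        tauto

theorem SimpleGraph.colorable_of_induce_compl_singleton {V : Type*} [Fintype V]
    {G : SimpleGraph V} [DecidableRel G.Adj] {n : ℕ} (v : V) (hv : G.degree v < n)
    (h : (G.induce {v}ᶜ).Colorable n) : G.Colorable n := by
  classical
  obtain ⟨C⟩ := h
  let f : V → Option (Fin n) := fun w => if hw : w = v then none else some (C ⟨w, hw⟩)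
  obtain ⟨c, hc⟩ : ∃ c : Fin n, some c ∉ (G.neighborFinset v).image f := by
    by_contra! hall
    have hsub : (Finset.univ : Finset (Fin n)).image some ⊆ (G.neighborFinset v).image f := by
      intro o ho
      obtain ⟨c, -, rfl⟩ := Finset.mem_image.1 ho
      exact hall c
    have hle := (Finset.card_le_card hsub).trans Finset.card_image_le
    rw [Finset.card_image_of_injective _ (Option.some_injective _), Finset.card_univ,
      Fintype.card_fin, SimpleGraph.card_neighborFinset_eq_degree] at hle
    omega
  have hfree : ∀ w (hw : w ≠ v), G.Adj v w → c ≠ C ⟨w, hw⟩ := by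
    intro w hw hvw hcw
    refine hc (Finset.mem_image.2 ⟨w, by simpa using hvw, ?_⟩)
    simp [f, hw, hcw]
  refine ⟨SimpleGraph.Coloring.mk (fun w => if hw : w = v then c else C ⟨w, hw⟩) ?_⟩
  intro a b hab
  by_cases ha : a = v
  · subst ha
    simpa [hab.ne'] using hfree b hab.ne' hab
  · by_cases hb : b = v
    · subst hb
      simpa [ha] using (hfree a ha hab.symm).symm
    · have hadj : (G.induce {v}ᶜ).Adj ⟨a, ha⟩ ⟨b, hb⟩ := hab
      simpa [ha, hb] using C.valid hadj

theorem HasSmallCuts.colorable {V : Type*} [Fintype V] {G : SimpleGraph V} {k m : ℕ} (hk : 0 < k)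
    (h : HasSmallCuts G k) (hm : G.CliqueFree (m + 1)) : G.Colorable (m + 2 * k - 1) := by
  classical
  induction hn : Fintype.card V generalizing V with
  | zero =>
    have := Fintype.card_eq_zero_iff.1 hn
    exact SimpleGraph.Colorable.of_isEmpty _
  | succ n ih =>
    have : Nonempty V := Fintype.card_pos_iff.1 (by omega)
    obtain ⟨v, hv⟩ := h.exists_degree_lt_of_boundary hm Finset.univ ∅ Finset.univ_nonempty
      (by simpa using hk) (by simp)
    refine SimpleGraph.colorable_of_induce_compl_singleton v hv
      (ih (h.induce _) (hm.comap ⟨(SimpleGraph.Embedding.induce _).toCopy⟩) ?_)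
    rw [Fintype.card_compl_set, hn]
    simp

theorem cliqueFree_cliqueNum_add_one {V : Type*} [Fintype V] (G : SimpleGraph V) :
    G.CliqueFree (cliqueNum G + 1) := by
  intro t ht
  have hbdd : BddAbove {n | ∃ s : Finset V, G.IsNClique n s} := by
    refine ⟨Fintype.card V, ?_⟩
    rintro _ ⟨s, hs⟩
    exact hs.card_eq ▸ s.card_le_univ
  exact Nat.not_succ_le_self _ (le_csSup hbdd ⟨t, ht⟩)

theorem separability_chi_bounded (k : ℕ) (hk : 0 < k)
    (V : Type) [Fintype V] (G : SimpleGraph V) (hsep : SeparabilityAtMost G k)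
    (s : Set V) :
    (G.induce s).chromaticNumber ≤ ((cliqueNum (G.induce s) + 2 * k ^ 2 - 1 : ℕ) : ℕ∞) := by
  classical
  refine (SimpleGraph.Colorable.chromaticNumber_le
    ((hsep.hasSmallCuts.induce s).colorable hk (cliqueFree_cliqueNum_add_one _))).trans ?_
  have : k ≤ k ^ 2 := Nat.le_self_pow two_ne_zero k
  exact_mod_cast (by omega :
    cliqueNum (G.induce s) + 2 * k - 1 ≤ cliqueNum (G.induce s) + 2 * k ^ 2 - 1)
end
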